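/- arXiv:1008.3002 — 3 statements merged into one kernel-verified Lean document; each statement's English description precedes it below -/
import Mathlib

section
/- Let p be a prime and G a nontrivial finite p-group. Set d = dim_{𝔽_p} H^1(G, 𝔽_p) and r = dim_{𝔽_p} H^2(G, 𝔽_p), where 𝔽_p carries the trivial G-action. Then r > d^2/4. -/
set_option maxSynthPendingDepth 3
set_option linter.unusedSectionVars false
set_option linter.style.haveILetI false

namespace GS

/-- numerical part -/
lemma numeric (a : ℕ → ℕ) (d r B : ℕ) (hd : 1 ≤ d) (h0 : a 0 = 0) (h1 : a 1 = 1)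
    (hB : ∀ n, a n ≤ B)
    (h : ∀ n, d * a (n + 1) + 1 ≤ a (n + 2) + r * a n) : d ^ 2 < 4 * r := by
  by_contra hcon
  push Not at hcon
  have key : ∀ n, n + 1 ≤ a (n + 1) ∧ d * a n + 2 ≤ 2 * a (n + 1) := by
    intro n
    induction n with
    | zero => simp [h0, h1]
    | succ n ih =>
      obtain ⟨ih1, ih2⟩ := ih
      have hn := h n
      have e2 : d * a (n + 1) + 2 ≤ 2 * a (n + 2) := by
        nlinarith [Nat.mul_le_mul_right (a n) hcon, Nat.mul_le_mul_left d ih2]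
      refine ⟨?_, e2⟩
      rcases Nat.lt_or_ge d 2 with hd2 | hd2
      · have hd1 : d = 1 := by omega
        subst hd1
        have hr : r = 0 := by omega
        subst hr
        have := h n
        simp at this
        show n + 1 + 1 ≤ a (n + 2)
        omega
      · have := Nat.mul_le_mul_right (a (n + 1)) hd2
        show n + 1 + 1 ≤ a (n + 2)
        omega
  have := (key B).1
  have := hB (B + 1)
  omega

section core
variable {k A : Type*} [Field k] [Ring A] [Algebra k A] [Module.Finite k A]

/-- the basic dimension inequality -/
lemma dim_ineq (I : Ideal A) [I.IsTwoSided] (hI : I ≠ ⊤) {d r : ℕ}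
    (x : Fin d → A) (hx : Ideal.span (Set.range x) = I)
    (ρ : Fin r → Fin d → A)
    (hρI : ∀ j i, ρ j i ∈ I)
    (hρ0 : ∀ v : Fin d → A, ∑ i, v i * x i = 0 → ∃ w : Fin r → A, v = ∑ j, w j • ρ j)
    (n : ℕ) :
    d * Module.finrank k (A ⧸ I ^ (n + 1)) + 1 ≤
      Module.finrank k (A ⧸ I ^ (n + 2)) + r * Module.finrank k (A ⧸ I ^ n) := by
  have hxI : ∀ i, x i ∈ I := fun i => hx ▸ Ideal.subset_span ⟨i, rfl⟩
  let mulR : ∀ (m : ℕ) (c : A), c ∈ I → (A ⧸ I ^ m) →ₗ[A] (A ⧸ I ^ (m + 1)) := fun m c hc =>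
    Submodule.mapQ (I ^ m) (I ^ (m + 1)) (LinearMap.toSpanSingleton A A c) (by
      intro y hy
      simp only [Submodule.mem_comap, LinearMap.toSpanSingleton_apply, smul_eq_mul]
      rw [Submodule.pow_succ]
      exact Ideal.mul_mem_mul hy hc)
  have mulR_mk : ∀ m c hc y, mulR m c hc (Submodule.Quotient.mk y) =
      Submodule.Quotient.mk (y * c) := fun m c hc y => rfl
  let Φ : (Fin d → A ⧸ I ^ (n + 1)) →ₗ[k] (A ⧸ I ^ (n + 2)) :=
    (∑ i, (mulR (n + 1) (x i) (hxI i)).comp (LinearMap.proj i)).restrictScalars k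
  let Ψ : (Fin r → A ⧸ I ^ n) →ₗ[k] (Fin d → A ⧸ I ^ (n + 1)) :=
    (LinearMap.pi fun i => ∑ j, (mulR n (ρ j i) (hρI j i)).comp (LinearMap.proj j)).restrictScalars k
  have hΦ : ∀ v : Fin d → A, Φ (fun i => Submodule.Quotient.mk (v i)) =
      Submodule.Quotient.mk (∑ i, v i * x i) := by
    intro v
    simp only [Φ, LinearMap.coe_restrictScalars, LinearMap.sum_apply, LinearMap.comp_apply,
      LinearMap.proj_apply, mulR_mk]
    exact (map_sum (Submodule.mkQ (I ^ (n + 2))) _ _).symm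
  have hΨ : ∀ w : Fin r → A, Ψ (fun j => Submodule.Quotient.mk (w j)) =
      fun i => Submodule.Quotient.mk (∑ j, w j * ρ j i) := by
    intro w
    funext i
    simp only [Ψ, LinearMap.coe_restrictScalars, LinearMap.pi_apply, LinearMap.sum_apply,
      LinearMap.comp_apply, LinearMap.proj_apply, mulR_mk]
    exact (map_sum (Submodule.mkQ (I ^ (n + 1))) _ _).symm
  have lift : ∀ (m q : ℕ) (v : Fin q → A ⧸ I ^ m), ∃ v' : Fin q → A,
      v = fun i => Submodule.Quotient.mk (v' i) := by
    intro m q v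
    choose v' hv' using fun i => Submodule.Quotient.mk_surjective _ (v i)
    exact ⟨v', by funext i; exact (hv' i).symm⟩
  have hpow : ∀ z ∈ I ^ (n + 2), ∃ u : Fin d → A, (∀ i, u i ∈ I ^ (n + 1)) ∧
      z = ∑ i, u i * x i := by
    intro z hz
    rw [Submodule.pow_succ] at hz
    refine Submodule.mul_induction_on hz ?_ ?_
    · intro y hy c hc
      rw [← hx] at hc
      obtain ⟨e, he⟩ := (Submodule.mem_span_range_iff_exists_fun A).1 hc
      refine ⟨fun i => y * e i, fun i => Ideal.mul_mem_right _ _ hy, ?_⟩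
      rw [← he, Finset.mul_sum]
      simp [mul_assoc]
    · rintro y z ⟨u, hu, rfl⟩ ⟨w, hw, rfl⟩
      refine ⟨fun i => u i + w i, fun i => add_mem (hu i) (hw i), ?_⟩
      simp [add_mul, Finset.sum_add_distrib]
  have hker : LinearMap.ker Φ ≤ LinearMap.range Ψ := by
    intro v hv
    obtain ⟨v, rfl⟩ := lift _ _ v
    rw [LinearMap.mem_ker, hΦ, Submodule.Quotient.mk_eq_zero] at hv
    obtain ⟨u, hu, hvu⟩ := hpow _ hv
    obtain ⟨w, hw⟩ := hρ0 (fun i => v i - u i) (by simp [sub_mul, hvu])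
    refine ⟨fun j => Submodule.Quotient.mk (w j), ?_⟩
    rw [hΨ]
    funext i
    rw [eq_comm, Submodule.Quotient.eq]
    have := congrFun hw i
    simp only [Finset.sum_apply, Pi.smul_apply, smul_eq_mul] at this
    rw [← this]
    simpa using hu i
  have hrange : LinearMap.range Φ ≠ ⊤ := by
    intro htop
    apply hI
    rw [Ideal.eq_top_iff_one]
    obtain ⟨v, hv⟩ := LinearMap.range_eq_top.1 htop (Submodule.Quotient.mk 1)
    obtain ⟨v, rfl⟩ := lift _ _ v
    rw [hΦ, eq_comm, Submodule.Quotient.eq] at hv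
    have h1 : (1 : A) - ∑ i, v i * x i ∈ I := Ideal.pow_le_self (by omega) hv
    have h2 : ∑ i, v i * x i ∈ I := sum_mem fun i _ => I.mul_mem_left _ (hxI i)
    simpa using add_mem h1 h2
  have e1 := LinearMap.finrank_range_add_finrank_ker Φ
  have e2 := Submodule.finrank_mono hker
  have e3 := LinearMap.finrank_range_le Ψ
  have e4 := Submodule.finrank_lt (lt_top_iff_ne_top.2 hrange).ne
  rw [Module.finrank_pi_fintype] at e1 e3
  simp only [Finset.sum_const, Finset.card_univ, Fintype.card_fin, smul_eq_mul] at e1 e3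
  omega

lemma finrank_quot_le (I : Ideal A) : Module.finrank k (A ⧸ I) ≤ Module.finrank k A :=
  LinearMap.finrank_le_finrank_of_surjective (f := I.mkQ.restrictScalars k)
    (fun y => Submodule.Quotient.mk_surjective _ y)

lemma finrank_quot (ε : A →ₐ[k] k) (I : Ideal A) (h : ∀ y, y ∈ I ↔ ε y = 0) :
    Module.finrank k (A ⧸ I) = 1 := by
  have hs : Function.Surjective ε.toLinearMap := fun c => ⟨algebraMap k A c, by simp⟩
  have e0 := LinearMap.finrank_range_add_finrank_ker ε.toLinearMap
  have hs2 : Function.Surjective (I.mkQ.restrictScalars k) :=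
    fun y => Submodule.Quotient.mk_surjective _ y
  have e1 := LinearMap.finrank_range_add_finrank_ker (I.mkQ.restrictScalars k)
  have hk : LinearMap.ker (I.mkQ.restrictScalars k) = LinearMap.ker ε.toLinearMap := by
    ext y
    rw [LinearMap.mem_ker, LinearMap.mem_ker, LinearMap.restrictScalars_apply,
      Submodule.mkQ_apply, Submodule.Quotient.mk_eq_zero, h]
    rfl
  rw [LinearMap.range_eq_top.2 hs, finrank_top, Module.finrank_self] at e0
  rw [LinearMap.range_eq_top.2 hs2, finrank_top, hk] at e1
  omega

lemma core (ε : A →ₐ[k] k) {d r : ℕ} (hd : 1 ≤ d)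
    (x : Fin d → A) (hx : Ideal.span (Set.range x) = RingHom.ker ε)
    (ρ : Fin r → Fin d → A)
    (hρI : ∀ j i, ρ j i ∈ RingHom.ker ε)
    (hρ0 : ∀ v : Fin d → A, ∑ i, v i * x i = 0 → ∃ w : Fin r → A, v = ∑ j, w j • ρ j) :
    d ^ 2 < 4 * r := by
  have hI : RingHom.ker ε ≠ ⊤ := RingHom.ker_ne_top _
  refine numeric (fun n => Module.finrank k (A ⧸ (RingHom.ker ε) ^ n)) d r (Module.finrank k A)
    hd ?_ ?_ ?_ (dim_ineq _ hI x hx ρ hρI hρ0)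
  · have : Subsingleton (A ⧸ (RingHom.ker ε) ^ 0) := by
      rw [Submodule.Quotient.subsingleton_iff, Submodule.pow_zero, Ideal.one_eq_top]
    exact Module.finrank_zero_of_subsingleton
  · exact finrank_quot ε _ fun y => by rw [Submodule.pow_one, RingHom.mem_ker]
  · exact fun n => finrank_quot_le _

/-- invariant functionals -/
def D (ε : A →ₐ[k] k) (V : Type*) [AddCommGroup V] [Module k V] [Module A V] :
    Submodule k (Module.Dual k V) where
  carrier := {f | ∀ (a : A) (x : V), f (a • x) = ε a * f x}
  zero_mem' := by intro a x; simp
  add_mem' := by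
    intro f g hf hg a x
    simp only [Set.mem_ofPred_eq] at hf hg
    simp [hf, hg, mul_add]
  smul_mem' := by
    intro c f hf a x
    simp only [Set.mem_ofPred_eq] at hf
    simp only [LinearMap.smul_apply, hf, smul_eq_mul]
    ring

lemma mem_D {ε : A →ₐ[k] k} {V : Type*} [AddCommGroup V] [Module k V] [Module A V]
    {f : Module.Dual k V} : f ∈ D ε V ↔ ∀ (a : A) (x : V), f (a • x) = ε a * f x := Iff.rfl

lemma gens (ε : A →ₐ[k] k) (V : Type*) [AddCommGroup V] [Module k V] [Module A V]
    [IsScalarTower k A V] [Module.Finite k V]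
    (hnak : ∀ N : Submodule A V, N ≠ ⊤ → ∃ f ∈ D ε V, f ≠ 0 ∧ ∀ x ∈ N, f x = 0) :
    ∃ x : Fin (Module.finrank k (D ε V)) → V, Submodule.span A (Set.range x) = ⊤ ∧
      ∀ v : Fin (Module.finrank k (D ε V)) → A, ∑ i, v i • x i = 0 → ∀ i, v i ∈ RingHom.ker ε := by
  classical
  let b := Module.finBasis k (D ε V)
  have hsurj : Function.Surjective
      ((D ε V).dualRestrict.comp (Module.Dual.eval k V)) := by
    rw [LinearMap.coe_comp]
    exact Subspace.dualRestrict_surjective.comp (Module.bijective_dual_eval k V).2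
  choose x hx using fun i => hsurj (b.coord i)
  have hxb : ∀ i (f : D ε V), (f : Module.Dual k V) (x i) = b.repr f i := by
    intro i f
    have := LinearMap.congr_fun (hx i) f
    simpa using this
  refine ⟨x, ?_, ?_⟩
  · by_contra hne
    obtain ⟨f, hf, hf0, hfN⟩ := hnak _ hne
    apply hf0
    have : (⟨f, hf⟩ : D ε V) = 0 := by
      apply b.repr.injective
      ext i
      rw [← hxb]
      simpa using hfN _ (Submodule.subset_span ⟨i, rfl⟩)
    simpa using congrArg Subtype.val this
  · intro v hv i
    rw [RingHom.mem_ker]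
    have h := congrArg (b i : Module.Dual k V) hv
    rw [map_sum, map_zero] at h
    have h2 : ∀ j, (b i : Module.Dual k V) (v j • x j) = if i = j then ε (v j) else 0 := by
      intro j
      rw [mem_D.1 (b i).2, hxb]
      simp [Finsupp.single_apply]
    simp only [h2] at h
    simpa using h

end core

section pgroup
open MonoidAlgebra
variable {p : ℕ} [Fact p.Prime] {G : Type} [Group G] [Finite G]

/-- augmentation -/
noncomputable def aug (p : ℕ) [Fact p.Prime] (G : Type) [Group G] :
    MonoidAlgebra (ZMod p) G →ₐ[ZMod p] ZMod p :=
  MonoidAlgebra.lift (ZMod p) (ZMod p) G 1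

@[simp] lemma aug_of (g : G) : aug p G (of (ZMod p) G g) = 1 := by
  simp [aug]

lemma mem_D_of {V : Type*} [AddCommGroup V] [Module (ZMod p) V] [Module (MonoidAlgebra (ZMod p) G) V]
    [IsScalarTower (ZMod p) (MonoidAlgebra (ZMod p) G) V] {f : Module.Dual (ZMod p) V}
    (hf : ∀ (g : G) (x : V), f (of (ZMod p) G g • x) = f x) : f ∈ D (aug p G) V := by
  intro a x
  induction a using MonoidAlgebra.induction_on with
  | of g => rw [hf, aug_of, one_mul]
  | add a b ha hb => rw [add_smul, map_add, ha, hb, map_add, add_mul]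
  | smul c a ha => rw [smul_assoc, map_smul, ha, map_smul]; simp [mul_assoc]

lemma exists_inv (hG : IsPGroup p G) (V : Type*) [AddCommGroup V] [Module (ZMod p) V]
    [Module (MonoidAlgebra (ZMod p) G) V]
    [IsScalarTower (ZMod p) (MonoidAlgebra (ZMod p) G) V] [Module.Finite (ZMod p) V]
    [Nontrivial V] : ∃ f ∈ D (aug p G) V, f ≠ 0 := by
  let act : G → V →ₗ[ZMod p] V := fun g => Algebra.lsmul (ZMod p) (ZMod p) V (of (ZMod p) G g)
  have act_apply : ∀ g x, act g x = of (ZMod p) G g • x := fun g x => rfl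
  letI : MulAction G (Module.Dual (ZMod p) V) :=
    { smul := fun g f => f.comp (act g⁻¹)
      one_smul := by
        intro f
        ext x
        show f (act 1⁻¹ x) = f x
        rw [act_apply, inv_one, map_one, one_smul]
      mul_smul := by
        intro g h f
        ext x
        show f (act (g * h)⁻¹ x) = f (act h⁻¹ (act g⁻¹ x))
        rw [act_apply, act_apply, act_apply, mul_inv_rev, map_mul, mul_smul] }
  have smul_def : ∀ (g : G) (f : Module.Dual (ZMod p) V) x, (g • f) x = f (act g⁻¹ x) :=
    fun g f x => rfl
  haveI : Finite (Module.Dual (ZMod p) V) := Module.finite_of_finite (ZMod p)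
  have hdvd : p ∣ Nat.card (Module.Dual (ZMod p) V) := by
    rw [Module.natCard_eq_pow_finrank (K := ZMod p), Nat.card_zmod, Subspace.dual_finrank_eq]
    exact dvd_pow_self _ (Module.finrank_pos).ne'
  obtain ⟨f, hf, hf0⟩ := hG.exists_fixed_point_of_prime_dvd_card_of_fixed_point
    (Module.Dual (ZMod p) V) hdvd (a := 0) (by
      intro g
      ext x
      rw [smul_def]; simp)
  refine ⟨f, mem_D_of fun g x => ?_, hf0.symm⟩
  have := LinearMap.congr_fun (hf g⁻¹) x
  rwa [smul_def, inv_inv, act_apply] at this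

lemma nak (hG : IsPGroup p G) (V : Type*) [AddCommGroup V] [Module (ZMod p) V]
    [Module (MonoidAlgebra (ZMod p) G) V]
    [IsScalarTower (ZMod p) (MonoidAlgebra (ZMod p) G) V] [Module.Finite (ZMod p) V]
    (N : Submodule (MonoidAlgebra (ZMod p) G) V) (hN : N ≠ ⊤) :
    ∃ f ∈ D (aug p G) V, f ≠ 0 ∧ ∀ x ∈ N, f x = 0 := by
  haveI : Nontrivial (V ⧸ N) := Submodule.Quotient.nontrivial_iff.2 hN
  haveI : Module.Finite (ZMod p) (V ⧸ N) :=
    Module.Finite.of_surjective (N.mkQ.restrictScalars (ZMod p)) (Submodule.mkQ_surjective _)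
  obtain ⟨f, hf, hf0⟩ := exists_inv hG (V ⧸ N)
  refine ⟨f.comp (N.mkQ.restrictScalars (ZMod p)), ?_, ?_, ?_⟩
  · intro a x
    simp [mem_D.1 hf]
  · intro h
    apply hf0
    refine LinearMap.ext fun y => ?_
    obtain ⟨x, rfl⟩ := Submodule.Quotient.mk_surjective _ y
    exact LinearMap.congr_fun h x
  · intro x hx
    rw [LinearMap.comp_apply, LinearMap.restrictScalars_apply, Submodule.mkQ_apply,
      (Submodule.Quotient.mk_eq_zero N).2 hx, map_zero]

/-- linear extension of a function on `G` -/
noncomputable def lin {W : Type*} [AddCommGroup W] [Module (ZMod p) W] (u : G → W) :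
    MonoidAlgebra (ZMod p) G →ₗ[ZMod p] W :=
  (Finsupp.linearCombination (ZMod p) u).comp
    (MonoidAlgebra.coeffLinearEquiv (ZMod p)).toLinearMap

@[simp] lemma lin_of {W : Type*} [AddCommGroup W] [Module (ZMod p) W] (u : G → W) (g : G) :
    lin u (of (ZMod p) G g) = u g := by
  simp [lin]

lemma of_ext {W : Type*} [AddCommGroup W] [Module (ZMod p) W]
    {f g : MonoidAlgebra (ZMod p) G →ₗ[ZMod p] W}
    (h : ∀ x, f (of (ZMod p) G x) = g (of (ZMod p) G x)) : f = g := by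
  refine LinearMap.ext fun a => ?_
  induction a using MonoidAlgebra.induction_on with
  | of x => exact h x
  | add a b ha hb => rw [map_add, map_add, ha, hb]
  | smul c a ha => rw [map_smul, map_smul, ha]

lemma lin_hom (φ : Additive G →+ ZMod p) (h : G) (a : MonoidAlgebra (ZMod p) G) :
    lin (fun g => φ (Additive.ofMul g)) (of (ZMod p) G h * a) =
      aug p G a * φ (Additive.ofMul h) + lin (fun g => φ (Additive.ofMul g)) a := by
  induction a using MonoidAlgebra.induction_on with
  | of x => rw [← map_mul, lin_of, lin_of, aug_of, one_mul, ofMul_mul, map_add]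
  | add a b ha hb => rw [mul_add, map_add, map_add, map_add, ha, hb]; ring
  | smul c a ha =>
    rw [mul_smul_comm, map_smul, map_smul, map_smul, ha]
    simp only [smul_eq_mul]
    ring

lemma of_sub_one_mem (g : G) : of (ZMod p) G g - 1 ∈ RingHom.ker (aug p G) := by
  rw [RingHom.mem_ker, map_sub, aug_of, map_one, sub_self]

/-- homs to functionals on the augmentation ideal -/
noncomputable def homToD : (Additive G →+ ZMod p) →ₗ[ZMod p] D (aug p G) (RingHom.ker (aug p G)) where
  toFun φ := ⟨(lin (fun g => φ (Additive.ofMul g))).comp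
      ((Submodule.subtype (RingHom.ker (aug p G))).restrictScalars (ZMod p)), by
    apply mem_D_of
    rintro g ⟨y, hy⟩
    rw [RingHom.mem_ker] at hy
    show lin _ (of (ZMod p) G g * y) = lin _ y
    rw [lin_hom, hy, zero_mul, zero_add]⟩
  map_add' φ ψ := by
    apply Subtype.ext
    refine LinearMap.ext fun y => ?_
    have : lin (p := p) (fun g => (φ + ψ) (Additive.ofMul g)) = lin (fun g => φ (Additive.ofMul g)) +
        lin (fun g => ψ (Additive.ofMul g)) := of_ext fun g => by simp [-of_apply]
    exact LinearMap.congr_fun this y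
  map_smul' c φ := by
    apply Subtype.ext
    refine LinearMap.ext fun y => ?_
    have : lin (p := p) (fun g => (c • φ) (Additive.ofMul g)) =
        c • lin (fun g => φ (Additive.ofMul g)) := of_ext fun g => by simp [-of_apply]
    exact LinearMap.congr_fun this y

lemma homToD_inj : Function.Injective (homToD (p := p) (G := G)) := by
  rw [injective_iff_map_eq_zero]
  intro φ hφ
  ext g
  have h := LinearMap.congr_fun (congrArg Subtype.val hφ) ⟨_, of_sub_one_mem g⟩
  have h2 : lin (fun g => φ (Additive.ofMul g)) (of (ZMod p) G g - 1) = 0 := h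
  rw [map_sub, lin_of, ← map_one (of (ZMod p) G), lin_of] at h2
  simpa using h2

lemma h1_le : Module.finrank (ZMod p) (groupCohomology.H1 (Rep.trivial (ZMod p) G (ZMod p))) ≤
    Module.finrank (ZMod p) (D (aug p G) (RingHom.ker (aug p G))) := by
  rw [(groupCohomology.H1IsoOfIsTrivial (Rep.trivial (ZMod p) G (ZMod p))).toLinearEquiv.finrank_eq]
  haveI : Module.Finite (ZMod p) (RingHom.ker (aug p G)) :=
    inferInstanceAs (Module.Finite (ZMod p) ((RingHom.ker (aug p G)).restrictScalars (ZMod p)))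
  exact LinearMap.finrank_le_finrank_of_injective (f := homToD (p := p) (G := G)) homToD_inj

section H2
variable {F : Type} [AddCommGroup F] [Module (ZMod p) F] [Module (MonoidAlgebra (ZMod p) G) F]
    [IsScalarTower (ZMod p) (MonoidAlgebra (ZMod p) G) F]
    (π : F →ₗ[MonoidAlgebra (ZMod p) G] MonoidAlgebra (ZMod p) G)
    (s : G → F) (hs : ∀ g, π (s g) = of (ZMod p) G g - 1)

/-- the factor set -/
noncomputable def fac (g h : G) : LinearMap.ker π :=
  ⟨s g + of (ZMod p) G g • s h - s (g * h), by
    rw [LinearMap.mem_ker, map_sub, map_add, map_smul, hs, hs, hs, map_mul, smul_eq_mul]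
    noncomm_ring⟩

/-- the transgression -/
noncomputable def trans : D (aug p G) (LinearMap.ker π) →ₗ[ZMod p]
    groupCohomology.cocycles₂ (Rep.trivial (ZMod p) G (ZMod p)) where
  toFun f := ⟨fun q => f.1 (fac π s hs q.1 q.2), by
    rw [groupCohomology.mem_cocycles₂_iff]
    intro g h j
    show f.1 (fac π s hs (g * h) j) + f.1 (fac π s hs g h) =
      f.1 (fac π s hs h j) + f.1 (fac π s hs g (h * j))
    have e := mem_D.1 f.2 (of (ZMod p) G g) (fac π s hs h j)
    rw [aug_of, one_mul] at e
    rw [← e, ← map_add, ← map_add]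
    congr 1
    apply Subtype.ext
    simp only [fac, Submodule.coe_add, Submodule.coe_smul, map_mul, mul_smul, smul_add, smul_sub,
      mul_assoc]
    abel⟩
  map_add' f f' := rfl
  map_smul' c f := rfl

lemma trans_apply (f : D (aug p G) (LinearMap.ker π)) (g h : G) :
    (trans π s hs f).1 (g, h) = f.1 (fac π s hs g h) := rfl

lemma trans_inj (hπ : ∀ v, aug p G (π v) = 0)
    (hD : ∀ f ∈ D (aug p G) F, ∀ v, π v = 0 → f v = 0)
    (f : D (aug p G) (LinearMap.ker π)) (u : G → ZMod p)
    (hu : ∀ g h, f.1 (fac π s hs g h) = u h - u (g * h) + u g) : f = 0 := by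
  let σ : MonoidAlgebra (ZMod p) G →ₗ[ZMod p] F := lin s
  let L : MonoidAlgebra (ZMod p) G →ₗ[ZMod p] ZMod p := lin u
  let πk : F →ₗ[ZMod p] MonoidAlgebra (ZMod p) G := π.restrictScalars (ZMod p)
  have hσ : ∀ a, π (σ a) = a - algebraMap (ZMod p) (MonoidAlgebra (ZMod p) G) (aug p G a) := by
    intro a
    have : πk.comp σ = LinearMap.id -
        (Algebra.linearMap (ZMod p) (MonoidAlgebra (ZMod p) G)).comp (aug p G).toLinearMap :=
      of_ext fun g => by
        simp only [LinearMap.comp_apply, σ, lin_of, LinearMap.sub_apply, LinearMap.id_apply,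
          AlgHom.toLinearMap_apply, aug_of, map_one, Algebra.linearMap_apply]
        exact hs g
    exact LinearMap.congr_fun this a
  let τ : F →ₗ[ZMod p] LinearMap.ker π :=
    { toFun := fun v => ⟨v - σ (π v), by
        rw [LinearMap.mem_ker, map_sub, hσ, hπ, map_zero, sub_zero, sub_self]⟩
      map_add' := fun v w => by
        apply Subtype.ext
        simp only [map_add, Submodule.coe_add]
        abel
      map_smul' := fun c v => by
        apply Subtype.ext
        have : π (c • v) = c • π v := πk.map_smul c v
        simp only [this, map_smul, RingHom.id_apply]
        exact (smul_sub c v (σ (π v))).symm }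
  have hτ : ∀ v, (τ v : F) = v - σ (π v) := fun v => rfl
  let E : F →ₗ[ZMod p] ZMod p := f.1.comp τ + L.comp πk
  have hE : ∀ v, E v = f.1 (τ v) + L (π v) := fun v => rfl
  -- key identity
  have key : ∀ (g : G) (a : MonoidAlgebra (ZMod p) G), aug p G a = 0 →
      ∃ z : LinearMap.ker π, (z : F) = of (ZMod p) G g • σ a - σ (of (ZMod p) G g * a) ∧
        f.1 z = L a - L (of (ZMod p) G g * a) := by
    intro g a ha
    suffices h : ∀ a, ∃ z : LinearMap.ker π, (z : F) = of (ZMod p) G g • σ a -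
        σ (of (ZMod p) G g * a) + aug p G a • s g ∧
        f.1 z = L a - L (of (ZMod p) G g * a) + aug p G a * u g by
      obtain ⟨z, h1, h2⟩ := h a
      rw [ha, zero_smul, add_zero] at h1
      rw [ha, zero_mul, add_zero] at h2
      exact ⟨z, h1, h2⟩
    intro a
    induction a using MonoidAlgebra.induction_on with
    | of x =>
      refine ⟨fac π s hs g x, ?_, ?_⟩
      · rw [← map_mul, aug_of, one_smul]
        simp only [σ, lin_of, fac]
        abel
      · rw [hu, ← map_mul, aug_of, one_mul]
        simp only [L, lin_of]
    | add a b ha hb =>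
      obtain ⟨z, h1, h2⟩ := ha
      obtain ⟨w, h3, h4⟩ := hb
      refine ⟨z + w, ?_, ?_⟩
      · rw [Submodule.coe_add, h1, h3, mul_add]
        simp only [map_add, smul_add, add_smul]
        abel
      · rw [map_add, h2, h4, mul_add]
        simp only [map_add]
        ring
    | smul c a ha =>
      obtain ⟨z, h1, h2⟩ := ha
      refine ⟨c • z, ?_, ?_⟩
      · have : ((c • z : LinearMap.ker π) : F) = c • (z : F) := rfl
        rw [this, h1, mul_smul_comm]
        simp only [map_smul, smul_add, smul_sub, smul_eq_mul, mul_smul]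
        rw [smul_algebra_smul_comm c (of (ZMod p) G g) (σ a)]
      · rw [map_smul, h2, mul_smul_comm]
        simp only [map_smul, smul_eq_mul]
        ring
  have hED : E ∈ D (aug p G) F := by
    apply mem_D_of
    intro g v
    obtain ⟨z, h1, h2⟩ := key g (π v) (hπ v)
    have h3 : τ (of (ZMod p) G g • v) = of (ZMod p) G g • τ v + z := by
      apply Subtype.ext
      rw [Submodule.coe_add, h1, Submodule.coe_smul, hτ, hτ, map_smul, smul_eq_mul, smul_sub]
      abel
    rw [hE, hE, h3, map_add, h2, mem_D.1 f.2, aug_of, map_smul, smul_eq_mul]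
    ring
  apply Subtype.ext
  refine LinearMap.ext fun v => ?_
  have hv : π v = 0 := v.2
  have h0 := hD E hED v hv
  have h4 : τ v = v := by
    apply Subtype.ext
    rw [hτ, hv, map_zero, sub_zero]
  rw [hE, h4, hv, map_zero, add_zero] at h0
  simpa using h0

lemma h2_le (hπ : ∀ v, aug p G (π v) = 0)
    (hD : ∀ f ∈ D (aug p G) F, ∀ v, π v = 0 → f v = 0)
    (hs : ∀ g, π (s g) = of (ZMod p) G g - 1) :
    Module.finrank (ZMod p) (D (aug p G) (LinearMap.ker π)) ≤
    Module.finrank (ZMod p) (groupCohomology.H2 (Rep.trivial (ZMod p) G (ZMod p))) := by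
  let A := Rep.trivial (ZMod p) G (ZMod p)
  have hsurj : Function.Surjective (groupCohomology.H2π A).hom :=
    (ModuleCat.epi_iff_surjective _).1 inferInstance
  haveI : Module.Finite (ZMod p) (groupCohomology.cocycles₂ A) :=
    inferInstanceAs (Module.Finite (ZMod p) (groupCohomology.cocycles₂ A : Submodule (ZMod p) (G × G → ZMod p)))
  haveI : Module.Finite (ZMod p) (groupCohomology.H2 A) :=
    Module.Finite.of_surjective (groupCohomology.H2π A).hom hsurj
  refine LinearMap.finrank_le_finrank_of_injective
    (f := (groupCohomology.H2π A).hom.comp (trans π s hs)) ?_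
  rw [injective_iff_map_eq_zero]
  intro f hf
  have hf' : groupCohomology.H2π A (trans π s hs f) = 0 := hf
  rw [groupCohomology.H2π_eq_zero_iff] at hf'
  obtain ⟨u, hu⟩ := hf'
  refine trans_inj π s hs hπ hD f u fun g h => ?_
  exact (congrFun hu (g, h)).symm

end H2

end pgroup

end GS

open groupCohomology in
/-- The Golod–Shafarevich inequality: for a nontrivial finite `p`-group `G`, with
`d = dim H¹(G,𝔽_p)` (generator rank) and `r = dim H²(G,𝔽_p)` (relation rank),
one has `r > d²/4`. -/
theorem golod_shafarevich_inequality (p : ℕ) [Fact p.Prime]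
    (G : Type) [Group G] [Finite G] (hG : IsPGroup p G) (hnt : Nontrivial G)
    (d r : ℕ)
    (hd : d = Module.finrank (ZMod p) (H1 (Rep.trivial (ZMod p) G (ZMod p))))
    (hr : r = Module.finrank (ZMod p) (H2 (Rep.trivial (ZMod p) G (ZMod p)))) :
    (r : ℝ) > (d : ℝ) ^ 2 / 4 := by
  let A := MonoidAlgebra (ZMod p) G
  let I : Ideal A := RingHom.ker (GS.aug p G)
  haveI : Module.Finite (ZMod p) I :=
    inferInstanceAs (Module.Finite (ZMod p) (I.restrictScalars (ZMod p)))
  have h1 : d ≤ _ := hd.trans_le GS.h1_le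
  obtain ⟨x, hx, hxrel⟩ := GS.gens (GS.aug p G) I (GS.nak hG I)
  generalize Module.finrank (ZMod p) (GS.D (GS.aug p G) (RingHom.ker (GS.aug p G))) = d' at *
  let π : (Fin d' → A) →ₗ[A] A := Fintype.linearCombination A (fun i => (x i : A))
  have hπ : ∀ v, π v = ∑ i, v i * (x i : A) := fun v => by
    simp [π, Fintype.linearCombination_apply]
  have hspan : Ideal.span (Set.range fun i => (x i : A)) = I := by
    have := congrArg (Submodule.map I.subtype) hx
    rw [Submodule.map_span, Submodule.map_top, Submodule.range_subtype, ← Set.range_comp] at this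
    exact this
  have hker : ∀ v, π v = 0 → ∀ i, v i ∈ I := by
    intro v hv
    apply hxrel
    apply Subtype.ext
    rw [hπ] at hv
    simpa using hv
  have hex : ∀ g : G, ∃ s, π s = MonoidAlgebra.of (ZMod p) G g - 1 := by
    intro g
    have hg : MonoidAlgebra.of (ZMod p) G g - 1 ∈ I := GS.of_sub_one_mem g
    rw [← hspan] at hg
    obtain ⟨c, hc⟩ := (Submodule.mem_span_range_iff_exists_fun A).1 hg
    exact ⟨c, by rw [hπ, ← hc]; rfl⟩
  choose s hs using hex
  have h2 := GS.h2_le π s (fun v => by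
    rw [hπ, map_sum]
    refine Finset.sum_eq_zero fun i _ => ?_
    have : GS.aug p G (x i) = 0 := (x i).2
    rw [map_mul, this, mul_zero]) (by
    classical
    intro f hf v hv
    have hv2 : v = ∑ i, v i • (Pi.single i (1 : A) : Fin d' → A) := by
      funext j
      simp [Finset.sum_apply, Pi.single_apply]
    rw [hv2, map_sum]
    refine Finset.sum_eq_zero fun i _ => ?_
    have : GS.aug p G (v i) = 0 := hker v hv i
    rw [GS.mem_D.1 hf, this, zero_mul]) hs
  haveI : Module.Finite (ZMod p) (LinearMap.ker π) :=
    inferInstanceAs (Module.Finite (ZMod p) ((LinearMap.ker π).restrictScalars (ZMod p)))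
  obtain ⟨ρ, hρ, -⟩ := GS.gens (GS.aug p G) (LinearMap.ker π) (GS.nak hG (LinearMap.ker π))
  rw [← hr] at h2
  generalize Module.finrank (ZMod p) (GS.D (GS.aug p G) (LinearMap.ker π)) = r' at *
  have hd1 : 1 ≤ d' := by
    by_contra hcon
    have h0 : d' = 0 := by omega
    subst h0
    obtain ⟨g, hg⟩ := exists_ne (1 : G)
    have h3 := hs g
    rw [hπ, Finset.univ_eq_empty, Finset.sum_empty, eq_comm, sub_eq_zero,
      ← map_one (MonoidAlgebra.of (ZMod p) G)] at h3
    exact hg (MonoidAlgebra.of_injective h3)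
  have main := GS.core (GS.aug p G) hd1 (fun i => (x i : A)) hspan (fun j => (ρ j : Fin d' → A))
    (fun j i => hker _ (ρ j).2 i) (by
      intro v hv
      rw [← hπ] at hv
      have hm : (⟨v, hv⟩ : LinearMap.ker π) ∈ Submodule.span A (Set.range ρ) := by
        rw [hρ]; trivial
      obtain ⟨w, hw⟩ := (Submodule.mem_span_range_iff_exists_fun A).1 hm
      refine ⟨w, ?_⟩
      have := congrArg Subtype.val hw
      simpa using this.symm)
  have h5 : d ^ 2 < 4 * r := by
    have := Nat.pow_le_pow_left h1 2
    omega
  have h6 : (d : ℝ) ^ 2 < 4 * r := by exact_mod_cast h5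
  linarith
end

section
/- Let m ≥ 2 be an integer and let d, r be positive real numbers with d < m·r and r ≤ d^m·(m-1)^{m-1}/m^m. Then the real number t* = (d/(m·r))^{1/(m-1)} lies in the open interval (0,1) and satisfies r·t*^m − d·t* + 1 ≤ 0. In particular, if r·t^m − d·t + 1 > 0 for all t ∈ (0,1) and d < m·r, then r > d^m·(m-1)^{m-1}/m^m. -/
/-- The real-analytic core of the refined Golod–Shafarevich inequality.  Let `m ≥ 2`
and let `d, r > 0` be reals with `d < m·r`.  If `r ≤ d^m (m-1)^{m-1}/m^m`, then
`t* = (d/(m r))^{1/(m-1)}` lies in `(0,1)` and `r t*^m - d t* + 1 ≤ 0`.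
In particular, if `r t^m - d t + 1 > 0` for all `t ∈ (0,1)`, then
`r > d^m (m-1)^{m-1}/m^m`. -/
theorem golod_shafarevich_optimization (m : ℕ) (hm : 2 ≤ m) (d r : ℝ)
    (hd : 0 < d) (hr : 0 < r) (hdmr : d < m * r) :
    (r ≤ d ^ m * ((m : ℝ) - 1) ^ (m - 1) / (m : ℝ) ^ m →
      (d / (m * r)) ^ ((1 : ℝ) / ((m : ℝ) - 1)) ∈ Set.Ioo (0 : ℝ) 1 ∧
      r * ((d / (m * r)) ^ ((1 : ℝ) / ((m : ℝ) - 1))) ^ m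
        - d * (d / (m * r)) ^ ((1 : ℝ) / ((m : ℝ) - 1)) + 1 ≤ 0) ∧
    ((∀ t ∈ Set.Ioo (0 : ℝ) 1, r * t ^ m - d * t + 1 > 0) →
      r > d ^ m * ((m : ℝ) - 1) ^ (m - 1) / (m : ℝ) ^ m) := by
  have key : r ≤ d ^ m * ((m : ℝ) - 1) ^ (m - 1) / (m : ℝ) ^ m →
      (d / (m * r)) ^ ((1 : ℝ) / ((m : ℝ) - 1)) ∈ Set.Ioo (0 : ℝ) 1 ∧
      r * ((d / (m * r)) ^ ((1 : ℝ) / ((m : ℝ) - 1))) ^ m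
        - d * (d / (m * r)) ^ ((1 : ℝ) / ((m : ℝ) - 1)) + 1 ≤ 0 := by
    intro h
    obtain ⟨n, rfl⟩ : ∃ n, m = n + 1 := ⟨m - 1, by omega⟩
    have hn : n ≠ 0 := by omega
    have hn0 : (0 : ℝ) < n := by exact_mod_cast Nat.pos_of_ne_zero hn
    have e1 : ((n + 1 : ℕ) : ℝ) - 1 = n := by push_cast; ring
    rw [e1] at h ⊢
    rw [Nat.add_sub_cancel] at h
    have hM : (0 : ℝ) < ((n + 1 : ℕ) : ℝ) := by positivity
    have hMn : ((n + 1 : ℕ) : ℝ) = n + 1 := by push_cast; ring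
    generalize ((n + 1 : ℕ) : ℝ) = M at *
    have hq : 0 < d / (M * r) := by positivity
    have hq1 : d / (M * r) < 1 := by rw [div_lt_one (by positivity)]; exact hdmr
    have ht0 : 0 < (d / (M * r)) ^ ((1 : ℝ) / (n : ℝ)) := Real.rpow_pos_of_pos hq _
    have ht1 : (d / (M * r)) ^ ((1 : ℝ) / (n : ℝ)) < 1 :=
      Real.rpow_lt_one hq.le hq1 (by positivity)
    have htn : ((d / (M * r)) ^ ((1 : ℝ) / (n : ℝ))) ^ n = d / (M * r) := by
      rw [one_div]; exact Real.rpow_inv_natCast_pow hq.le hn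
    generalize (d / (M * r)) ^ ((1 : ℝ) / (n : ℝ)) = t at *
    refine ⟨⟨ht0, ht1⟩, ?_⟩
    have h1 : 1 ≤ d * t * n / M := by
      by_contra hlt
      have hlt := pow_lt_one₀ (by positivity) (not_le.mp hlt) hn
      have e : (d * t * n / M) ^ n = d ^ (n + 1) * (n : ℝ) ^ n / M ^ (n + 1) / r := by
        rw [div_pow, mul_pow, mul_pow, htn]
        field_simp
        ring
      rw [e, div_lt_one hr] at hlt
      linarith
    have e2 : r * t ^ (n + 1) - d * t + 1 = 1 - d * t * n / M := by
      rw [pow_succ, htn]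
      field_simp
      rw [hMn]; ring
    rw [e2]; linarith
  refine ⟨key, fun H => ?_⟩
  by_contra hc
  obtain ⟨h1, h2⟩ := key (not_lt.mp hc)
  have := H _ h1
  linarith
end

section
/- (Koch–Venkov classification, analytic form) Let m_1 ≤ m_2 be odd integers with m_1 ≥ 3. Then the inequality t^{m_1} + t^{m_2} − 2t + 1 > 0 holds for all t ∈ (0,1) if and only if (m_1, m_2) ∈ {(3,3), (3,5), (3,7)}. -/
theorem kv_37 (t : ℝ) (h0 : 0 < t) (h1 : t < 1) : 0 < t ^ 3 + t ^ 7 - 2 * t + 1 := by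
  have e3 : 0 ≤ (t - 2/3)^2 * (t + 4/3) := by positivity
  have e7 : 0 ≤ (t - 2/3)^2 * (t^5 + 2*(2/3)*t^4 + 3*(2/3)^2*t^3 + 4*(2/3)^3*t^2
    + 5*(2/3)^4*t + 6*(2/3)^5) := by positivity
  ring_nf at e3 e7 ⊢
  linarith

/-- Koch–Venkov classification, analytic form: for odd integers `3 ≤ m₁ ≤ m₂`, the
inequality `t^{m₁} + t^{m₂} - 2t + 1 > 0` holds for all `t ∈ (0,1)` if and only if
`(m₁, m₂) ∈ {(3,3), (3,5), (3,7)}`. -/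
theorem koch_venkov_classification (m₁ m₂ : ℕ) (h₁ : Odd m₁) (h₂ : Odd m₂)
    (h₃ : 3 ≤ m₁) (h₁₂ : m₁ ≤ m₂) :
    (∀ t : ℝ, t ∈ Set.Ioo (0 : ℝ) 1 → 0 < t ^ m₁ + t ^ m₂ - 2 * t + 1) ↔
      (m₁, m₂) ∈ ({(3, 3), (3, 5), (3, 7)} : Set (ℕ × ℕ)) := by
  simp only [Set.mem_insert_iff, Set.mem_singleton_iff, Prod.mk.injEq]
  constructor
  · intro h
    have ht := h (67/100) ⟨by norm_num, by norm_num⟩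
    have mono : ∀ a b : ℕ, a ≤ b → (67/100 : ℝ)^b ≤ (67/100)^a := fun a b hab =>
      pow_le_pow_of_le_one (by norm_num) (by norm_num) hab
    obtain ⟨a, rfl⟩ := h₁
    obtain ⟨b, rfl⟩ := h₂
    have ha : a = 1 := by
      by_contra hne
      have q1 := mono 5 (2*a+1) (by omega)
      have q2 := mono 5 (2*b+1) (by omega)
      norm_num at q1 q2 ht
      linarith
    have hb : b ≤ 3 := by
      by_contra hne
      have q1 := mono 3 (2*a+1) (by omega)
      have q2 := mono 9 (2*b+1) (by omega)
      norm_num at q1 q2 ht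
      linarith
    omega
  · intro h t ht
    have k := kv_37 t ht.1 ht.2
    have mono : ∀ a : ℕ, a ≤ 7 → t^7 ≤ t^a := fun a hab =>
      pow_le_pow_of_le_one ht.1.le ht.2.le hab
    have m3 := mono 3 (by norm_num)
    have m5 := mono 5 (by norm_num)
    rcases h with ⟨rfl, rfl⟩ | ⟨rfl, rfl⟩ | ⟨rfl, rfl⟩ <;> linarith
end
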